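/- Let f, u : ℝⁿ → ℝ be smooth ℤⁿ-periodic functions, g : ℝⁿ → ℝ twice continuously differentiable, and ξ ∈ ℝ. Writing v = v(∇u), Q = Q(∇u), and Dv for the Jacobian of x ↦ v(∇u(x)), one has ∫_{[0,1]ⁿ} ∇g(∇u)·∇( Q div_f v + ξ u ) dμ = −∫_{[0,1]ⁿ} g(∇u) (div_f v)² dμ + ∫_{[0,1]ⁿ} v·( D²f ( g(∇u) v − Q ∇g(∇u) ) ) dμ + ∫_{[0,1]ⁿ} ⟨ D²u(Id − v vᵀ), ( (g(∇u)/Q²)(Id − v vᵀ) − D²g(∇u) ) D²u ⟩_F dμ + ∫_{[0,1]ⁿ} ⟨ (Dv)ᵀ, v ⊗ (D²u ∇g(∇u)) − ∇g(∇u) ⊗ (D²u v) ⟩_F dμ + ξ ∫_{[0,1]ⁿ} ∇g(∇u)·∇u dμ, where ⟨M,N⟩_F = Σ_{i,j} M_{ij}N_{ij} is the Frobenius inner product and a ⊗ b denotes the matrix with entries aᵢbⱼ. -/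

import Mathlib

noncomputable section

open MeasureTheory

variable {n : ℕ}

/-- `i`-th partial derivative. -/
def pderiv1 (u : (Fin n → ℝ) → ℝ) (i : Fin n) (x : Fin n → ℝ) : ℝ :=
  fderiv ℝ u x (Pi.single i 1)

/-- Gradient. -/
def grad (u : (Fin n → ℝ) → ℝ) (x : Fin n → ℝ) : Fin n → ℝ :=
  fun i => pderiv1 u i x

/-- Hessian matrix. -/
def hess (u : (Fin n → ℝ) → ℝ) (x : Fin n → ℝ) : Matrix (Fin n) (Fin n) ℝ :=
  Matrix.of fun i j => pderiv1 (pderiv1 u j) i x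

/-- Laplacian. -/
def lap (u : (Fin n → ℝ) → ℝ) (x : Fin n → ℝ) : ℝ :=
  ∑ i, pderiv1 (pderiv1 u i) i x

/-- Euclidean dot product. -/
def dot (a b : Fin n → ℝ) : ℝ := ∑ i, a i * b i

/-- ℤⁿ-periodicity. -/
def ZPeriodic (u : (Fin n → ℝ) → ℝ) : Prop :=
  ∀ (x : Fin n → ℝ) (k : Fin n → ℤ), u (x + fun i => (k i : ℝ)) = u x

/-- Area element `Q(p) = √(1+|p|²)`. -/
def Qe (p : Fin n → ℝ) : ℝ := Real.sqrt (1 + ∑ i, p i ^ 2)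

/-- `v(p) = p / √(1+|p|²)`. -/
def vv (p : Fin n → ℝ) : Fin n → ℝ := fun i => p i / Qe p

/-- Divergence of a vector field. -/
def dvg (V : (Fin n → ℝ) → (Fin n → ℝ)) (x : Fin n → ℝ) : ℝ :=
  ∑ i, fderiv ℝ (fun y => V y i) x (Pi.single i 1)

/-- Weighted divergence `div_f V = div V − ∇f·V`. -/
def divf (f : (Fin n → ℝ) → ℝ) (V : (Fin n → ℝ) → (Fin n → ℝ)) (x : Fin n → ℝ) : ℝ :=
  dvg V x - dot (grad f x) (V x)

/-- Frobenius inner product of matrices. -/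
def frob (A B : Matrix (Fin n) (Fin n) ℝ) : ℝ := ∑ i, ∑ j, A i j * B i j

/-- Jacobian matrix of a vector field: `(DV)_{ij} = ∂_j V_i`. -/
def jac (V : (Fin n → ℝ) → (Fin n → ℝ)) (x : Fin n → ℝ) : Matrix (Fin n) (Fin n) ℝ :=
  Matrix.of fun i j => fderiv ℝ (fun y => V y i) x (Pi.single j 1)

section Calculus

lemma pderiv1_mul {a b : (Fin n → ℝ) → ℝ} (ha : Differentiable ℝ a) (hb : Differentiable ℝ b)
    (i : Fin n) (x : Fin n → ℝ) :
    pderiv1 (fun y => a y * b y) i x = pderiv1 a i x * b x + a x * pderiv1 b i x := by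
  simp only [pderiv1]
  rw [fderiv_fun_mul (ha x) (hb x)]
  simp
  ring

lemma pderiv1_add {a b : (Fin n → ℝ) → ℝ} (ha : Differentiable ℝ a) (hb : Differentiable ℝ b)
    (i : Fin n) (x : Fin n → ℝ) :
    pderiv1 (fun y => a y + b y) i x = pderiv1 a i x + pderiv1 b i x := by
  simp only [pderiv1]
  rw [fderiv_fun_add (ha x) (hb x)]
  simp

lemma pderiv1_sub {a b : (Fin n → ℝ) → ℝ} (ha : Differentiable ℝ a) (hb : Differentiable ℝ b)
    (i : Fin n) (x : Fin n → ℝ) :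
    pderiv1 (fun y => a y - b y) i x = pderiv1 a i x - pderiv1 b i x := by
  simp only [pderiv1]
  rw [fderiv_fun_sub (ha x) (hb x)]
  simp

lemma pderiv1_const_mul {a : (Fin n → ℝ) → ℝ} (ha : Differentiable ℝ a) (c : ℝ)
    (i : Fin n) (x : Fin n → ℝ) :
    pderiv1 (fun y => c * a y) i x = c * pderiv1 a i x := by
  simp only [pderiv1]
  rw [fderiv_const_mul (ha x) c]
  simp

lemma pderiv1_sum {ι : Type*} (s : Finset ι) {a : ι → (Fin n → ℝ) → ℝ}
    (ha : ∀ k, Differentiable ℝ (a k)) (i : Fin n) (x : Fin n → ℝ) :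
    pderiv1 (fun y => ∑ k ∈ s, a k y) i x = ∑ k ∈ s, pderiv1 (a k) i x := by
  simp only [pderiv1]
  rw [fderiv_fun_sum (fun k _ => ha k x)]
  simp

/-- Chain rule for partial derivatives. -/
lemma pderiv1_comp {a : (Fin n → ℝ) → ℝ} {V : (Fin n → ℝ) → (Fin n → ℝ)}
    (ha : Differentiable ℝ a) (hV : ∀ k, Differentiable ℝ (fun y => V y k))
    (i : Fin n) (x : Fin n → ℝ) :
    pderiv1 (fun y => a (V y)) i x
      = ∑ k, pderiv1 a k (V x) * pderiv1 (fun y => V y k) i x := by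
  have hV' : Differentiable ℝ V := differentiable_pi.2 hV
  have h := fderiv_fun_comp x (ha (V x)) (hV' x)
  simp only [pderiv1]
  have e : fderiv ℝ (fun y => a (V y)) x (Pi.single i 1)
      = fderiv ℝ a (V x) (fderiv ℝ V x (Pi.single i 1)) := by
    rw [h]; rfl
  have e2 : ∀ k, fderiv ℝ (fun y => V y k) x (Pi.single i 1)
      = (fderiv ℝ V x (Pi.single i 1)) k := by
    intro k
    rw [fderiv_pi (fun k => hV k x)]
    rfl
  rw [e]
  simp only [e2]
  generalize fderiv ℝ V x (Pi.single i 1) = y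
  conv_lhs => rw [pi_eq_sum_univ' y]
  rw [map_sum]
  refine Finset.sum_congr rfl fun k _ => ?_
  rw [map_smul, smul_eq_mul, mul_comm]

lemma contDiff_pderiv1 {a : (Fin n → ℝ) → ℝ} {k m : WithTop ℕ∞} (ha : ContDiff ℝ k a)
    (hm : m + 1 ≤ k) (i : Fin n) : ContDiff ℝ m (pderiv1 a i) :=
  (ha.fderiv_right hm).clm_apply contDiff_const

/-- Mixed partial derivatives of a `C²` function commute. -/
lemma pderiv1_comm {a : (Fin n → ℝ) → ℝ} (ha : ContDiff ℝ 2 a) (i j : Fin n) (x : Fin n → ℝ) :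
    pderiv1 (pderiv1 a j) i x = pderiv1 (pderiv1 a i) j x := by
  have hd : DifferentiableAt ℝ (fderiv ℝ a) x :=
    (ha.fderiv_right (m := 1) (by norm_num)).differentiable (by norm_num) x
  have e : ∀ i j : Fin n, pderiv1 (pderiv1 a j) i x
      = fderiv ℝ (fderiv ℝ a) x (Pi.single i 1) (Pi.single j 1) := by
    intro i j
    unfold pderiv1
    rw [fderiv_clm_apply hd (differentiableAt_const _)]
    simp
  rw [e, e]
  exact (ha.contDiffAt.isSymmSndFDerivAt (by simp)).eq _ _

lemma ZPeriodic.pderiv1 {a : (Fin n → ℝ) → ℝ} (ha : ZPeriodic a) (i : Fin n) :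
    ZPeriodic (pderiv1 a i) := by
  intro x k
  unfold _root_.pderiv1
  rw [← fderiv_comp_add_right]
  congr 2
  funext y
  exact ha y k

/-- The integral over the unit cube of a partial derivative of a periodic function vanishes. -/
lemma integral_pderiv1_eq_zero {a : (Fin n → ℝ) → ℝ} (ha : ContDiff ℝ 1 a) (hp : ZPeriodic a)
    (i : Fin n) : ∫ x in Set.Icc (0 : Fin n → ℝ) 1, pderiv1 a i x = 0 := by
  obtain _ | m := n
  · exact i.elim0
  have hc : Continuous (pderiv1 a i) :=
    (contDiff_pderiv1 ha (m := 0) (by norm_num) i).continuous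
  have e : ∀ x, ∑ j, (if j = i then fderiv ℝ a x else 0) (Pi.single j 1) = pderiv1 a i x := by
    intro x
    rw [Finset.sum_eq_single i] <;> simp +contextual [pderiv1]
  have key := integral_divergence_of_hasFDerivAt_off_countable' (E := ℝ) (0 : Fin (m + 1) → ℝ) 1
    (fun _ => zero_le_one) (fun j x => if j = i then a x else 0)
    (fun j x => if j = i then fderiv ℝ a x else 0) ∅ Set.countable_empty
    (fun j => by
      by_cases h : j = i
      · simpa [h] using ha.continuous.continuousOn
      · simpa [h] using continuousOn_const)
    (fun x _ j => by
      by_cases h : j = i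
      · simpa [h] using (ha.differentiable (by norm_num) x).hasFDerivAt
      · simpa [h] using hasFDerivAt_const (0 : ℝ) x)
    (by
      simp only [e]
      exact hc.continuousOn.integrableOn_Icc)
  simp only [e] at key
  rw [key]
  refine Finset.sum_eq_zero fun j _ => ?_
  by_cases h : j = i
  · subst h
    simp only [if_true, Pi.one_apply, Pi.zero_apply]
    rw [sub_eq_zero]
    congr 1
    funext y
    have := hp (j.insertNth 0 y) (Pi.single j 1)
    rw [← this]
    congr 1
    funext k
    refine Fin.succAboveCases j ?_ (fun l => ?_) k <;> simp
  · simp [h]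

end Calculus

section AreaElement

lemma one_add_sum_sq_pos (p : Fin n → ℝ) : 0 < 1 + ∑ i, p i ^ 2 := by positivity

lemma Qe_pos (p : Fin n → ℝ) : 0 < Qe p := Real.sqrt_pos.2 (one_add_sum_sq_pos p)

lemma contDiff_Qe {k : WithTop ℕ∞} : ContDiff ℝ k (Qe : (Fin n → ℝ) → ℝ) :=
  ContDiff.sqrt (by fun_prop) fun p => (one_add_sum_sq_pos p).ne'

lemma contDiff_vv {k : WithTop ℕ∞} (i : Fin n) : ContDiff ℝ k (fun p : Fin n → ℝ => vv p i) :=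
  ContDiff.div (by fun_prop) contDiff_Qe fun p => (Qe_pos p).ne'

lemma pderiv1_coord (k i : Fin n) (x : Fin n → ℝ) :
    pderiv1 (fun y => y k) i x = if k = i then 1 else 0 := by
  unfold pderiv1
  have h : HasFDerivAt (fun y : Fin n → ℝ => y k)
    (ContinuousLinearMap.proj (R := ℝ) (φ := fun _ : Fin n => ℝ) k) x := hasFDerivAt_apply k x
  rw [h.fderiv]
  simp [Pi.single_apply]

lemma pderiv1_Qe (i : Fin n) (p : Fin n → ℝ) : pderiv1 Qe i p = vv p i := by
  have hQ : Differentiable ℝ (Qe : (Fin n → ℝ) → ℝ) := contDiff_Qe (k := 1).differentiable (by norm_num)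
  have h : (fun y : Fin n → ℝ => Qe y * Qe y) = fun y => 1 + ∑ k, y k * y k := by
    funext y
    rw [Qe, Real.mul_self_sqrt (one_add_sum_sq_pos y).le]
    simp only [sq]
  have h1 := pderiv1_mul hQ hQ i p
  rw [h, pderiv1_add (by fun_prop) (by fun_prop),
    pderiv1_sum _ (fun k => by fun_prop)] at h1
  have h2 : ∀ k : Fin n, pderiv1 (fun y : Fin n → ℝ => y k * y k) i p
      = if k = i then 2 * p k else 0 := by
    intro k
    rw [pderiv1_mul (by fun_prop) (by fun_prop), pderiv1_coord]
    split_ifs <;> ring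
  have h3 : pderiv1 (fun _ : Fin n → ℝ => (1 : ℝ)) i p = 0 := by simp [pderiv1]
  simp only [h2, h3, Finset.sum_ite_eq', Finset.mem_univ, if_true] at h1
  rw [vv, eq_div_iff (Qe_pos p).ne']
  linarith

end AreaElement

section Algebra

/-- Double-sum bookkeeping behind the divergence identity at a point. -/
lemma divergence_bookkeeping (q F d : ℝ) (G qd Fd w fd dd : Fin n → ℝ)
    (D Gd fH DD : Fin n → Fin n → ℝ)
    (hfH : ∀ i j, fH i j = fH j i)
    (hd : d = ∑ j, D j j - ∑ j, fd j * w j)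
    (hdd : ∀ i, dd i = ∑ j, DD j i - ∑ j, (fH i j * w j + fd j * D j i))
    (hGq : ∑ i, G i * qd i = ∑ j, Fd j * w j) :
    ∑ j, (qd j * ∑ i, G i * D j i + q * ∑ i, (Gd i j * D j i + G i * DD j i)
        + ((Fd j * d + F * dd j) * w j + F * d * D j j)
        - (Fd j * ∑ i, w i * D j i + F * ∑ i, (D i j * D j i + w i * DD j i))
        - fd j * (q * ∑ i, G i * D j i + F * d * w j - F * ∑ i, w i * D j i))
      = ∑ i, G i * (qd i * d + q * dd i) + F * d ^ 2
        - ∑ i, w i * ∑ j, fH i j * (F * w j - q * G j)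
        - ∑ i, ∑ j, (F * (D j i * D i j) - q * (D j i * Gd i j))
        - ∑ i, ∑ j, D j i * (w i * Fd j - G i * qd j) := by
  have h5 : ∑ j, dd j * w j = ∑ j, ∑ i, w i * DD j i - ∑ i, ∑ j, w i * fH i j * w j
      - ∑ j, ∑ i, fd j * w i * D j i := by
    rw [Finset.sum_comm, Finset.sum_comm (f := fun j i => fd j * w i * D j i),
      ← Finset.sum_sub_distrib, ← Finset.sum_sub_distrib]
    refine Finset.sum_congr rfl fun i _ => ?_
    rw [hdd, Finset.sum_add_distrib]
    simp only [sub_mul, add_mul, Finset.sum_mul]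
    simp only [sub_sub]
    congr 1
    · exact Finset.sum_congr rfl fun j _ => by ring
    · congr 1 <;> exact Finset.sum_congr rfl fun j _ => by ring
  have h15 : ∑ j, dd j * G j = ∑ j, ∑ i, G i * DD j i - ∑ i, ∑ j, w i * fH i j * G j
      - ∑ j, ∑ i, fd j * G i * D j i := by
    rw [Finset.sum_comm, Finset.sum_comm (f := fun j i => fd j * G i * D j i),
      Finset.sum_comm (f := fun i j => w i * fH i j * G j),
      ← Finset.sum_sub_distrib, ← Finset.sum_sub_distrib]
    refine Finset.sum_congr rfl fun i _ => ?_
    rw [hdd, Finset.sum_add_distrib]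
    simp only [sub_mul, add_mul, Finset.sum_mul]
    simp only [sub_sub]
    congr 1
    · exact Finset.sum_congr rfl fun j _ => by ring
    · congr 1
      · exact Finset.sum_congr rfl fun j _ => by rw [hfH]; ring
      · exact Finset.sum_congr rfl fun j _ => by ring
  have hL : ∑ j, (qd j * ∑ i, G i * D j i + q * ∑ i, (Gd i j * D j i + G i * DD j i)
        + ((Fd j * d + F * dd j) * w j + F * d * D j j)
        - (Fd j * ∑ i, w i * D j i + F * ∑ i, (D i j * D j i + w i * DD j i))
        - fd j * (q * ∑ i, G i * D j i + F * d * w j - F * ∑ i, w i * D j i))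
      = ∑ j, ∑ i, qd j * G i * D j i + q * ∑ j, ∑ i, Gd i j * D j i
        + q * ∑ j, ∑ i, G i * DD j i + d * ∑ j, Fd j * w j + F * ∑ j, dd j * w j
        + F * d * ∑ j, D j j - ∑ j, ∑ i, Fd j * w i * D j i
        - F * ∑ j, ∑ i, D i j * D j i - F * ∑ j, ∑ i, w i * DD j i
        - q * ∑ j, ∑ i, fd j * G i * D j i - F * d * ∑ j, fd j * w j
        + F * ∑ j, ∑ i, fd j * w i * D j i := by
    simp only [Finset.mul_sum (s := (Finset.univ : Finset (Fin n))), ← Finset.sum_add_distrib,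
      ← Finset.sum_sub_distrib]
    refine Finset.sum_congr rfl fun j _ => ?_
    simp only [mul_assoc, ← Finset.mul_sum, Finset.sum_add_distrib]
    ring
  have hR1 : ∑ i, G i * (qd i * d + q * dd i)
      = d * ∑ i, G i * qd i + q * ∑ j, dd j * G j := by
    simp only [Finset.mul_sum, ← Finset.sum_add_distrib]
    exact Finset.sum_congr rfl fun j _ => by ring
  have hR2 : ∑ i, w i * ∑ j, fH i j * (F * w j - q * G j)
      = F * ∑ i, ∑ j, w i * fH i j * w j - q * ∑ i, ∑ j, w i * fH i j * G j := by
    simp only [Finset.mul_sum, ← Finset.sum_sub_distrib]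
    exact Finset.sum_congr rfl fun i _ => Finset.sum_congr rfl fun j _ => by ring
  have hR3 : ∑ i, ∑ j, (F * (D j i * D i j) - q * (D j i * Gd i j))
      = F * ∑ j, ∑ i, D i j * D j i - q * ∑ j, ∑ i, Gd i j * D j i := by
    rw [Finset.sum_comm]
    simp only [Finset.mul_sum, ← Finset.sum_sub_distrib]
    exact Finset.sum_congr rfl fun i _ => Finset.sum_congr rfl fun j _ => by ring
  have hR4 : ∑ i, ∑ j, D j i * (w i * Fd j - G i * qd j)
      = ∑ j, ∑ i, Fd j * w i * D j i - ∑ j, ∑ i, qd j * G i * D j i := by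
    rw [Finset.sum_comm]
    simp only [← Finset.sum_sub_distrib]
    exact Finset.sum_congr rfl fun i _ => Finset.sum_congr rfl fun j _ => by ring
  rw [hL, hR1, hR2, hR3, hR4, h5, h15, hGq]
  linear_combination (-(F * d)) * hd

end Algebra

section Divergence

variable {f q F d : (Fin n → ℝ) → ℝ} {G w : Fin n → (Fin n → ℝ) → ℝ}

lemma pderiv1_weighted_field (hf : ContDiff ℝ 2 f) (hq : Differentiable ℝ q)
    (hF : Differentiable ℝ F) (hd : Differentiable ℝ d) (hG : ∀ i, Differentiable ℝ (G i))
    (hw : ∀ i, ContDiff ℝ 2 (w i)) (j : Fin n) (x : Fin n → ℝ) :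
    pderiv1 (fun y => (q y * ∑ i, G i y * pderiv1 (w j) i y + F y * d y * w j y
        - F y * ∑ i, w i y * pderiv1 (w j) i y) * Real.exp (-f y)) j x
      = (pderiv1 q j x * ∑ i, G i x * pderiv1 (w j) i x
          + q x * ∑ i, (pderiv1 (G i) j x * pderiv1 (w j) i x
            + G i x * pderiv1 (pderiv1 (w j) i) j x)
        + ((pderiv1 F j x * d x + F x * pderiv1 d j x) * w j x + F x * d x * pderiv1 (w j) j x)
        - (pderiv1 F j x * ∑ i, w i x * pderiv1 (w j) i x
          + F x * ∑ i, (pderiv1 (w i) j x * pderiv1 (w j) i x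
            + w i x * pderiv1 (pderiv1 (w j) i) j x))
        - pderiv1 f j x * (q x * ∑ i, G i x * pderiv1 (w j) i x + F x * d x * w j x
          - F x * ∑ i, w i x * pderiv1 (w j) i x)) * Real.exp (-f x) := by
  have hf' : Differentiable ℝ f := hf.differentiable (by norm_num)
  have hw' : ∀ i, Differentiable ℝ (w i) := fun i => (hw i).differentiable (by norm_num)
  have hD : ∀ i, Differentiable ℝ (pderiv1 (w j) i) := fun i =>
    (contDiff_pderiv1 (hw j) (m := 1) (by norm_num) i).differentiable (by norm_num)
  have hexp : pderiv1 (fun y => Real.exp (-f y)) j x = -pderiv1 f j x * Real.exp (-f x) := by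
    simp only [pderiv1]
    rw [fderiv_exp (hf'.fun_neg x), fderiv_fun_neg]
    simp
    ring
  have hS1 : Differentiable ℝ (fun y => ∑ i, G i y * pderiv1 (w j) i y) := by fun_prop
  have hS2 : Differentiable ℝ (fun y => ∑ i, w i y * pderiv1 (w j) i y) := by fun_prop
  rw [pderiv1_mul (by fun_prop) (by fun_prop), hexp, pderiv1_sub (by fun_prop) (by fun_prop),
    pderiv1_add (by fun_prop) (by fun_prop), pderiv1_mul hq hS1, pderiv1_mul hF hS2,
    pderiv1_mul (by fun_prop) (hw' j), pderiv1_mul hF hd,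
    pderiv1_sum _ (fun i => by fun_prop), pderiv1_sum _ (fun i => by fun_prop)]
  simp only [fun i => pderiv1_mul (hG i) (hD i) j x, fun i => pderiv1_mul (hw' i) (hD i) j x]
  ring

/-- Partial derivatives of the weighted divergence. -/
lemma pderiv1_weighted_divergence (hf : ContDiff ℝ 2 f) (hw : ∀ i, ContDiff ℝ 2 (w i))
    (hdiv : ∀ y, d y = ∑ j, pderiv1 (w j) j y - ∑ j, pderiv1 f j y * w j y)
    (i : Fin n) (x : Fin n → ℝ) :
    pderiv1 d i x = ∑ j, pderiv1 (pderiv1 (w j) i) j x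
      - ∑ j, (hess f x i j * w j x + pderiv1 f j x * pderiv1 (w j) i x) := by
  have hw' : ∀ i, Differentiable ℝ (w i) := fun i => (hw i).differentiable (by norm_num)
  have hD : ∀ j i, Differentiable ℝ (pderiv1 (w j) i) := fun j i =>
    (contDiff_pderiv1 (hw j) (m := 1) (by norm_num) i).differentiable (by norm_num)
  have hfD : ∀ i, Differentiable ℝ (pderiv1 f i) := fun i =>
    (contDiff_pderiv1 hf (m := 1) (by norm_num) i).differentiable (by norm_num)
  rw [funext hdiv, pderiv1_sub (by fun_prop) (by fun_prop), pderiv1_sum _ (fun j => hD j j),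
    pderiv1_sum _ (fun i => by fun_prop)]
  simp only [fun j => pderiv1_mul (hfD j) (hw' j) i x]
  congr 1
  exact Finset.sum_congr rfl fun j _ => pderiv1_comm (hw j) i j x

/-- The divergence of the field `q (Dw) G + F d w - F (Dw) w`, weighted by `e^{-f}`. -/
lemma sum_pderiv1_weighted_field (hf : ContDiff ℝ 2 f) (hq : Differentiable ℝ q)
    (hF : Differentiable ℝ F) (hd : Differentiable ℝ d) (hG : ∀ i, Differentiable ℝ (G i))
    (hw : ∀ i, ContDiff ℝ 2 (w i))
    (hdiv : ∀ y, d y = ∑ j, pderiv1 (w j) j y - ∑ j, pderiv1 f j y * w j y)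
    (x : Fin n → ℝ)
    (hGq : ∑ i, G i x * pderiv1 q i x = ∑ j, pderiv1 F j x * w j x) :
    ∑ j, pderiv1 (fun y => (q y * ∑ i, G i y * pderiv1 (w j) i y + F y * d y * w j y
        - F y * ∑ i, w i y * pderiv1 (w j) i y) * Real.exp (-f y)) j x
      = (∑ i, G i x * (pderiv1 q i x * d x + q x * pderiv1 d i x) + F x * d x ^ 2
        - ∑ i, w i x * ∑ j, hess f x i j * (F x * w j x - q x * G j x)
        - ∑ i, ∑ j, (F x * (pderiv1 (w j) i x * pderiv1 (w i) j x)
            - q x * (pderiv1 (w j) i x * pderiv1 (G i) j x))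
        - ∑ i, ∑ j, pderiv1 (w j) i x * (w i x * pderiv1 F j x - G i x * pderiv1 q j x))
        * Real.exp (-f x) := by
  simp only [fun j => pderiv1_weighted_field hf hq hF hd hG hw j x]
  rw [← Finset.sum_mul, divergence_bookkeeping (q x) (F x) (d x) (fun i => G i x)
    (fun i => pderiv1 q i x) (fun i => pderiv1 F i x) (fun i => w i x) (fun i => pderiv1 f i x)
    (fun i => pderiv1 d i x) (fun i j => pderiv1 (w i) j x) (fun i j => pderiv1 (G i) j x)
    (fun i j => hess f x i j) (fun j i => pderiv1 (pderiv1 (w j) i) j x)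
    (fun i j => pderiv1_comm hf i j x) (hdiv x)
    (fun i => pderiv1_weighted_divergence hf hw hdiv i x) hGq]

end Divergence

section GradientCalculus

variable {u g : (Fin n → ℝ) → ℝ}

lemma differentiable_grad_apply (hu : ContDiff ℝ 2 u) (k : Fin n) :
    Differentiable ℝ (fun y => grad u y k) :=
  (contDiff_pderiv1 hu (m := 1) (by norm_num) k).differentiable (by norm_num)

lemma contDiff_grad {k m : WithTop ℕ∞} (hu : ContDiff ℝ k u) (hm : m + 1 ≤ k) :
    ContDiff ℝ m (grad u) :=
  contDiff_pi.2 fun i => contDiff_pderiv1 hu hm i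

lemma hess_comm (hu : ContDiff ℝ 2 u) (x : Fin n → ℝ) (i j : Fin n) :
    hess u x i j = hess u x j i :=
  pderiv1_comm hu i j x

lemma pderiv1_comp_grad (hu : ContDiff ℝ 2 u) (hg : Differentiable ℝ g) (j : Fin n)
    (x : Fin n → ℝ) :
    pderiv1 (fun y => g (grad u y)) j x = (hess u x).mulVec (grad g (grad u x)) j := by
  rw [pderiv1_comp hg (differentiable_grad_apply hu)]
  exact Finset.sum_congr rfl fun k _ => mul_comm _ _

lemma pderiv1_Qe_grad (hu : ContDiff ℝ 2 u) (j : Fin n) (x : Fin n → ℝ) :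
    pderiv1 (fun y => Qe (grad u y)) j x = (hess u x).mulVec (vv (grad u x)) j := by
  rw [pderiv1_comp_grad hu (contDiff_Qe (k := 1).differentiable (by norm_num))]
  congr 2
  funext i
  exact pderiv1_Qe i _

lemma Qe_mul_pderiv1_vv_grad (hu : ContDiff ℝ 2 u) (i j : Fin n) (x : Fin n → ℝ) :
    Qe (grad u x) * pderiv1 (fun y => vv (grad u y) i) j x
      = hess u x j i - vv (grad u x) i * (hess u x).mulVec (vv (grad u x)) j := by
  have hg : Differentiable ℝ (grad u) := differentiable_pi.2 (differentiable_grad_apply hu)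
  have hq : Differentiable ℝ (fun y => Qe (grad u y)) :=
    (contDiff_Qe (k := 1).differentiable (by norm_num)).comp hg
  have hw : Differentiable ℝ (fun y => vv (grad u y) i) :=
    (contDiff_vv (k := 1) i |>.differentiable (by norm_num)).comp hg
  have h := pderiv1_mul hq hw j x
  have e : (fun y => Qe (grad u y) * vv (grad u y) i) = pderiv1 u i := by
    funext y
    exact mul_div_cancel₀ _ (Qe_pos _).ne'
  rw [e, pderiv1_Qe_grad hu] at h
  rw [show hess u x j i = pderiv1 (pderiv1 u i) j x from rfl, h]
  ring

lemma hess_mul_projection (hu : ContDiff ℝ 2 u) (i j : Fin n) (x : Fin n → ℝ) :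
    (hess u x * ((1 : Matrix (Fin n) (Fin n) ℝ)
      - Matrix.vecMulVec (vv (grad u x)) (vv (grad u x)))) i j
      = Qe (grad u x) * pderiv1 (fun y => vv (grad u y) j) i x := by
  rw [Qe_mul_pderiv1_vv_grad hu, Matrix.mul_sub, Matrix.mul_one, Matrix.mul_vecMulVec,
    Matrix.sub_apply, Matrix.vecMulVec_apply]
  ring

lemma projection_mul_hess (hu : ContDiff ℝ 2 u) (i j : Fin n) (x : Fin n → ℝ) :
    (((1 : Matrix (Fin n) (Fin n) ℝ)
      - Matrix.vecMulVec (vv (grad u x)) (vv (grad u x))) * hess u x) i j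
      = Qe (grad u x) * pderiv1 (fun y => vv (grad u y) i) j x := by
  have hs : (hess u x).transpose = hess u x := by
    ext a b
    exact hess_comm hu x b a
  rw [Qe_mul_pderiv1_vv_grad hu, Matrix.sub_mul, Matrix.one_mul, Matrix.vecMulVec_mul,
    Matrix.sub_apply, Matrix.vecMulVec_apply, ← Matrix.mulVec_transpose, hs, hess_comm hu x i j]

lemma hess_comp_grad_mul_hess (hu : ContDiff ℝ 2 u) (hg : ContDiff ℝ 2 g) (i j : Fin n)
    (x : Fin n → ℝ) :
    (hess g (grad u x) * hess u x) i j = pderiv1 (fun y => pderiv1 g i (grad u y)) j x := by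
  rw [pderiv1_comp ((contDiff_pderiv1 hg (m := 1) (by norm_num) i).differentiable (by norm_num))
    (differentiable_grad_apply hu), Matrix.mul_apply]
  refine Finset.sum_congr rfl fun k _ => ?_
  rw [hess_comm hg, hess_comm hu]
  rfl

lemma frob_second_variation (hu : ContDiff ℝ 2 u) (hg : ContDiff ℝ 2 g) (x : Fin n → ℝ) :
    frob (hess u x * ((1 : Matrix (Fin n) (Fin n) ℝ)
          - Matrix.vecMulVec (vv (grad u x)) (vv (grad u x))))
        (((g (grad u x) / Qe (grad u x) ^ 2) • ((1 : Matrix (Fin n) (Fin n) ℝ)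
            - Matrix.vecMulVec (vv (grad u x)) (vv (grad u x)))
          - hess g (grad u x)) * hess u x)
      = ∑ i, ∑ j, (g (grad u x) * (pderiv1 (fun y => vv (grad u y) j) i x
              * pderiv1 (fun y => vv (grad u y) i) j x)
            - Qe (grad u x) * (pderiv1 (fun y => vv (grad u y) j) i x
              * pderiv1 (fun y => pderiv1 g i (grad u y)) j x)) := by
  refine Finset.sum_congr rfl fun i _ => Finset.sum_congr rfl fun j _ => ?_
  have hQ := (Qe_pos (grad u x)).ne'
  rw [hess_mul_projection hu, Matrix.sub_mul, Matrix.smul_mul, Matrix.sub_apply,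
    Matrix.smul_apply, projection_mul_hess hu, hess_comp_grad_mul_hess hu hg, smul_eq_mul]
  field_simp

lemma frob_jac_transpose (hu : ContDiff ℝ 2 u) (hg : Differentiable ℝ g) (x : Fin n → ℝ) :
    frob (jac (fun z => vv (grad u z)) x).transpose
        (Matrix.vecMulVec (vv (grad u x)) ((hess u x).mulVec (grad g (grad u x)))
          - Matrix.vecMulVec (grad g (grad u x)) ((hess u x).mulVec (vv (grad u x))))
      = ∑ i, ∑ j, pderiv1 (fun y => vv (grad u y) j) i x
          * (vv (grad u x) i * pderiv1 (fun y => g (grad u y)) j x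
            - pderiv1 g i (grad u x) * pderiv1 (fun y => Qe (grad u y)) j x) := by
  refine Finset.sum_congr rfl fun i _ => Finset.sum_congr rfl fun j _ => ?_
  rw [pderiv1_comp_grad hu hg, pderiv1_Qe_grad hu]
  rfl

lemma sum_grad_mul_pderiv1_Qe (hu : ContDiff ℝ 2 u) (hg : Differentiable ℝ g) (x : Fin n → ℝ) :
    ∑ i, pderiv1 g i (grad u x) * pderiv1 (fun y => Qe (grad u y)) i x
      = ∑ j, pderiv1 (fun y => g (grad u y)) j x * vv (grad u x) j := by
  have hs : (hess u x).transpose = hess u x := by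
    ext a b
    exact hess_comm hu x b a
  simp only [pderiv1_comp_grad hu hg, pderiv1_Qe_grad hu]
  change grad g (grad u x) ⬝ᵥ (hess u x).mulVec (vv (grad u x))
    = (hess u x).mulVec (grad g (grad u x)) ⬝ᵥ vv (grad u x)
  rw [Matrix.dotProduct_mulVec, ← Matrix.mulVec_transpose, hs]

end GradientCalculus

lemma ZPeriodic.grad_eq {u : (Fin n → ℝ) → ℝ} (hu : ZPeriodic u) (x : Fin n → ℝ)
    (k : Fin n → ℤ) : grad u (x + fun i => (k i : ℝ)) = grad u x :=
  funext fun i => hu.pderiv1 i x k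

/-- Integrating a linear combination of continuous functions over the unit cube. -/
lemma integral_cube_combination {l t₁ t₂ t₃ t₄ t₅ s : (Fin n → ℝ) → ℝ} {ξ : ℝ}
    (h₁ : Continuous t₁) (h₂ : Continuous t₂) (h₃ : Continuous t₃) (h₄ : Continuous t₄)
    (h₅ : Continuous t₅) (hs : Continuous s)
    (hs0 : ∫ x in Set.Icc (0 : Fin n → ℝ) 1, s x = 0)
    (hl : ∀ x, l x = -t₁ x + t₂ x + t₃ x + t₄ x + ξ * t₅ x + s x) :
    ∫ x in Set.Icc (0 : Fin n → ℝ) 1, l x =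
      -(∫ x in Set.Icc (0 : Fin n → ℝ) 1, t₁ x) + (∫ x in Set.Icc (0 : Fin n → ℝ) 1, t₂ x)
        + (∫ x in Set.Icc (0 : Fin n → ℝ) 1, t₃ x) + (∫ x in Set.Icc (0 : Fin n → ℝ) 1, t₄ x)
        + ξ * ∫ x in Set.Icc (0 : Fin n → ℝ) 1, t₅ x := by
  have int : ∀ {a : (Fin n → ℝ) → ℝ}, Continuous a →
      Integrable a (volume.restrict (Set.Icc (0 : Fin n → ℝ) 1)) :=
    fun h => h.continuousOn.integrableOn_Icc
  simp only [hl]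
  rw [integral_add (int (by fun_prop)) (int hs), integral_add (int (by fun_prop)) (int (by fun_prop)),
    integral_add (int (by fun_prop)) (int h₄), integral_add (int (by fun_prop)) (int h₃),
    integral_add (int (by fun_prop)) (int h₂), integral_neg, integral_const_mul, hs0, add_zero]

/-- the term `λ_fmcf`: writing `v = v(∇u)`, `Q = Q(∇u)` and
`Dv` for the Jacobian of `x ↦ v(∇u(x))`,
`∫ ∇g(∇u)·∇(Q div_f v + ξu) dμ
  = −∫ g(∇u)(div_f v)² dμ + ∫ v·(D²f(g(∇u)v − Q∇g(∇u))) dμ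
    + ∫ ⟨D²u(Id − v vᵀ), ((g(∇u)/Q²)(Id − v vᵀ) − D²g(∇u))D²u⟩_F dμ
    + ∫ ⟨(Dv)ᵀ, v ⊗ (D²u∇g(∇u)) − ∇g(∇u) ⊗ (D²u v)⟩_F dμ
    + ξ ∫ ∇g(∇u)·∇u dμ`
for smooth periodic `f, u`, `g ∈ C²` and `ξ ∈ ℝ`, with `dμ = e^{-f} dx` on `[0,1]ⁿ`. -/
theorem lambda_fmcf_identity
    (f u g : (Fin n → ℝ) → ℝ) (ξ : ℝ)
    (hf : ContDiff ℝ (⊤ : ℕ∞) f) (hu : ContDiff ℝ (⊤ : ℕ∞) u)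
    (hg : ContDiff ℝ 2 g)
    (hfp : ZPeriodic f) (hup : ZPeriodic u) :
    ∫ x in Set.Icc (0 : Fin n → ℝ) 1,
        dot (grad g (grad u x))
          (grad (fun y =>
            Qe (grad u y) * divf f (fun z => vv (grad u z)) y + ξ * u y) x)
          * Real.exp (-f x) =
      -(∫ x in Set.Icc (0 : Fin n → ℝ) 1,
          g (grad u x) * (divf f (fun z => vv (grad u z)) x) ^ 2 * Real.exp (-f x))
      + (∫ x in Set.Icc (0 : Fin n → ℝ) 1,
          dot (vv (grad u x))
            ((hess f x).mulVec
              (fun i => g (grad u x) * vv (grad u x) i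
                - Qe (grad u x) * grad g (grad u x) i)) * Real.exp (-f x))
      + (∫ x in Set.Icc (0 : Fin n → ℝ) 1,
          frob
            (hess u x *
              ((1 : Matrix (Fin n) (Fin n) ℝ)
                - Matrix.vecMulVec (vv (grad u x)) (vv (grad u x))))
            (((g (grad u x) / Qe (grad u x) ^ 2) •
                ((1 : Matrix (Fin n) (Fin n) ℝ)
                  - Matrix.vecMulVec (vv (grad u x)) (vv (grad u x)))
              - hess g (grad u x)) * hess u x) * Real.exp (-f x))
      + (∫ x in Set.Icc (0 : Fin n → ℝ) 1,
          frob (jac (fun z => vv (grad u z)) x).transpose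
            (Matrix.vecMulVec (vv (grad u x))
                ((hess u x).mulVec (grad g (grad u x)))
              - Matrix.vecMulVec (grad g (grad u x))
                ((hess u x).mulVec (vv (grad u x)))) * Real.exp (-f x))
      + ξ * ∫ x in Set.Icc (0 : Fin n → ℝ) 1,
          dot (grad g (grad u x)) (grad u x) * Real.exp (-f x) := by
  have two_le : (2 : WithTop ℕ∞) ≤ ((⊤ : ℕ∞) : WithTop ℕ∞) :=
    WithTop.coe_le_coe.2 (le_top (a := (2 : ℕ∞)))
  have one_le : (1 : WithTop ℕ∞) ≤ ((⊤ : ℕ∞) : WithTop ℕ∞) := by exact_mod_cast le_top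
  have hf2 : ContDiff ℝ 2 f := hf.of_le two_le
  have hu2 : ContDiff ℝ 2 u := hu.of_le two_le
  have hg1 : Differentiable ℝ g := hg.differentiable (by norm_num)
  have hp : ContDiff ℝ (⊤ : ℕ∞) (grad u) := contDiff_grad hu (by simp)
  have hp1 : ContDiff ℝ 1 (grad u) := hp.of_le one_le
  have hqC : ContDiff ℝ (⊤ : ℕ∞) (fun y => Qe (grad u y)) := contDiff_Qe.comp hp
  have hwC : ∀ i, ContDiff ℝ (⊤ : ℕ∞) (fun y => vv (grad u y) i) := fun i =>
    (contDiff_vv i).comp hp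
  have hDC : ∀ i j, ContDiff ℝ (⊤ : ℕ∞) (pderiv1 (fun y => vv (grad u y) i) j) := fun i j =>
    contDiff_pderiv1 (hwC i) (by simp) j
  have hfC : ∀ i, ContDiff ℝ (⊤ : ℕ∞) (pderiv1 f i) := fun i => contDiff_pderiv1 hf (by simp) i
  have hdiv : ∀ y, divf f (fun z => vv (grad u z)) y
      = ∑ j, pderiv1 (fun y => vv (grad u y) j) j y - ∑ j, pderiv1 f j y * vv (grad u y) j :=
    fun y => rfl
  have hdC : ContDiff ℝ (⊤ : ℕ∞) (divf f (fun z => vv (grad u z))) := by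
    rw [funext hdiv]
    exact (ContDiff.sum fun j _ => hDC j j).sub (ContDiff.sum fun j _ => (hfC j).mul (hwC j))
  have hFC : ContDiff ℝ 1 (fun y => g (grad u y)) := (hg.of_le (by norm_num)).comp hp1
  have hGC : ∀ i, ContDiff ℝ 1 (fun y => pderiv1 g i (grad u y)) := fun i =>
    (contDiff_pderiv1 hg (by norm_num) i).comp hp1
  -- the field whose weighted divergence is the difference of the two sides
  let X : Fin n → (Fin n → ℝ) → ℝ := fun j y =>
    (Qe (grad u y) * ∑ i, pderiv1 g i (grad u y) * pderiv1 (fun y => vv (grad u y) j) i y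
      + g (grad u y) * divf f (fun z => vv (grad u z)) y * vv (grad u y) j
      - g (grad u y) * ∑ i, vv (grad u y) i * pderiv1 (fun y => vv (grad u y) j) i y)
      * Real.exp (-f y)
  have hXC : ∀ j, ContDiff ℝ 1 (X j) := fun j =>
    ((((hqC.of_le one_le).mul
      (ContDiff.sum fun i _ => (hGC i).mul ((hDC j i).of_le one_le))).add
      ((hFC.mul (hdC.of_le one_le)).mul ((hwC j).of_le one_le))).sub
      (hFC.mul (ContDiff.sum fun i _ => ((hwC i).of_le one_le).mul ((hDC j i).of_le one_le)))).mul
      (hf.of_le one_le).neg.exp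
  have hwp : ∀ i, ZPeriodic (fun y => vv (grad u y) i) := fun i x k => by
    simp only [hup.grad_eq]
  have hdp : ZPeriodic (divf f (fun z => vv (grad u z))) := fun x k => by
    simp only [hdiv, hup.grad_eq, (hfp.pderiv1 _) x k, ((hwp _).pderiv1 _) x k]
  have hXp : ∀ j, ZPeriodic (X j) := fun j x k => by
    simp only [X, hup.grad_eq, hfp x k, hdp x k, ((hwp _).pderiv1 _) x k]
  have hX0 : ∫ x in Set.Icc (0 : Fin n → ℝ) 1, ∑ j, pderiv1 (X j) j x = 0 := by
    rw [integral_finsetSum _ fun j _ =>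
      ((contDiff_pderiv1 (hXC j) (m := 0) (by norm_num) j).continuous.continuousOn.integrableOn_Icc)]
    exact Finset.sum_eq_zero fun j _ => integral_pderiv1_eq_zero (hXC j) (hXp j) j
  have hX : ∀ x, ∑ j, pderiv1 (X j) j x = _ := fun x =>
    sum_pderiv1_weighted_field hf2 (hqC.differentiable (by simp)) (hFC.differentiable (by simp))
      (hdC.differentiable (by simp)) (fun i => (hGC i).differentiable (by simp))
      (fun i => (hwC i).of_le two_le) hdiv x (sum_grad_mul_pderiv1_Qe hu2 hg1 x)
  have hL : ∀ x, dot (grad g (grad u x)) (grad (fun y =>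
        Qe (grad u y) * divf f (fun z => vv (grad u z)) y + ξ * u y) x)
      = ∑ i, pderiv1 g i (grad u x) * (pderiv1 (fun y => Qe (grad u y)) i x
          * divf f (fun z => vv (grad u z)) x
          + Qe (grad u x) * pderiv1 (divf f (fun z => vv (grad u z))) i x)
        + ξ * dot (grad g (grad u x)) (grad u x) := by
    intro x
    have hqd : Differentiable ℝ (fun y => Qe (grad u y)) := hqC.differentiable (by simp)
    have hdd : Differentiable ℝ (divf f (fun z => vv (grad u z))) := hdC.differentiable (by simp)
    have hud : Differentiable ℝ u := hu.differentiable (by simp)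
    simp only [dot, grad, Finset.mul_sum, ← Finset.sum_add_distrib]
    refine Finset.sum_congr rfl fun i _ => ?_
    rw [pderiv1_add (hqd.fun_mul hdd) (hud.const_mul ξ), pderiv1_mul hqd hdd, pderiv1_const_mul hud]
    ring
  have hT2 : ∀ x, dot (vv (grad u x)) ((hess f x).mulVec
        (fun i => g (grad u x) * vv (grad u x) i - Qe (grad u x) * grad g (grad u x) i))
      = ∑ i, vv (grad u x) i * ∑ j, hess f x i j
        * (g (grad u x) * vv (grad u x) j - Qe (grad u x) * pderiv1 g j (grad u x)) :=
    fun x => rfl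
  simp only [hL, hT2, frob_second_variation hu2 hg, frob_jac_transpose hu2 hg1]
  have cE : Continuous fun x => Real.exp (-f x) := hf.continuous.neg.rexp
  have cq := hqC.continuous
  have cw := fun i => (hwC i).continuous
  have cD := fun i j => (hDC i j).continuous
  have cd := hdC.continuous
  have cF := hFC.continuous
  have cG := fun i => (hGC i).continuous
  have cqj := fun j => (contDiff_pderiv1 hqC (m := 0) (by simp) j).continuous
  have cFj := fun j => (contDiff_pderiv1 hFC (m := 0) (by simp) j).continuous
  have cGj := fun i j => (contDiff_pderiv1 (hGC i) (m := 0) (by simp) j).continuous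
  have cH : ∀ i j, Continuous fun x => hess f x i j := fun i j =>
    (contDiff_pderiv1 (hfC j) (m := 0) (by simp) i).continuous
  have cp : ∀ i, Continuous fun x => grad u x i := fun i =>
    (continuous_apply i).comp hp.continuous
  have c1 : Continuous fun x => g (grad u x) * divf f (fun z => vv (grad u z)) x ^ 2
      * Real.exp (-f x) := by fun_prop
  have c2 : Continuous fun x => (∑ i, vv (grad u x) i * ∑ j, hess f x i j
      * (g (grad u x) * vv (grad u x) j - Qe (grad u x) * pderiv1 g j (grad u x)))
      * Real.exp (-f x) := by fun_prop
  have c3 : Continuous fun x => (∑ i, ∑ j, (g (grad u x) * (pderiv1 (fun y => vv (grad u y) j) i x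
      * pderiv1 (fun y => vv (grad u y) i) j x)
      - Qe (grad u x) * (pderiv1 (fun y => vv (grad u y) j) i x
      * pderiv1 (fun y => pderiv1 g i (grad u y)) j x))) * Real.exp (-f x) := by fun_prop
  have c4 : Continuous fun x => (∑ i, ∑ j, pderiv1 (fun y => vv (grad u y) j) i x
      * (vv (grad u x) i * pderiv1 (fun y => g (grad u y)) j x
      - pderiv1 g i (grad u x) * pderiv1 (fun y => Qe (grad u y)) j x)) * Real.exp (-f x) := by
    fun_prop
  have c5 : Continuous fun x => dot (grad g (grad u x)) (grad u x) * Real.exp (-f x) :=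
    (continuous_finsetSum _ fun i _ => (cG i).mul (cp i)).mul cE
  have c6 : Continuous fun x => ∑ j, pderiv1 (X j) j x :=
    continuous_finsetSum _ fun j _ => (contDiff_pderiv1 (hXC j) (m := 0) (by norm_num) j).continuous
  refine integral_cube_combination c1 c2 c3 c4 c5 c6 hX0 fun x => ?_
  rw [hX]
  ring
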